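/- Let M = (M_j)_{j≥0} be a strongly regular sequence and let V be a vector subspace of ℝⁿ. Then for every real τ > 0 there exist a real nonnegative C^∞ function v_τ on ℝⁿ and positive constants d₁, d₂, d₃ depending only on M and V (not on τ) such that: (a) v_τ belongs to the class C_M(ℝⁿ), i.e. there exist σ > 0 and C > 0 with |D^J v_τ(x)| ≤ C σ^{|J|} |J|! M_{|J|} for all multi-indices J and x ∈ ℝⁿ; (b) v_τ is flat on V, i.e. D^J v_τ vanishes at every point of V for every J; (c) v_τ(x) > 0 for every x ∈ ℝⁿ \ V; and (d) for every multi-index J and every x ∈ ℝⁿ \ V, |D^J(1/v_τ)(x)| ≤ d₁ (d₂ τ)^{|J|} |J|! M_{|J|} · (h_M(d₃ τ · dist(x,V)))^{-1}. -/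

import Mathlib

noncomputable section

open Filter MeasureTheory
open scoped Topology

def StronglyRegularWith (M : ℕ → ℝ) (A : ℝ) : Prop :=
  (∀ j, 0 < M j) ∧ M 0 = 1 ∧ Monotone M ∧
  (∀ j : ℕ, M (j + 1) * M (j + 1) ≤ M j * M (j + 2)) ∧
  1 ≤ A ∧
  (∀ j k : ℕ, M (j + k) ≤ A ^ (j + k) * (M j * M k)) ∧
  (∀ ℓ N : ℕ, ∑ j ∈ Finset.range N,
      M (ℓ + j) / (((ℓ + j : ℕ) + 1 : ℝ) * M (ℓ + j + 1)) ≤ A * (M ℓ / M (ℓ + 1)))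

def StronglyRegular (M : ℕ → ℝ) : Prop := ∃ A : ℝ, StronglyRegularWith M A

noncomputable def hfn (M : ℕ → ℝ) (t : ℝ) : ℝ :=
  if t = 0 then 0 else ⨅ j : ℕ, t ^ j * M j

def PropertyP (M : ℕ → ℝ) (γ : ℝ) : Prop :=
  ∃ (m' : ℕ → ℝ) (a : ℝ), 1 ≤ a ∧ (∀ j, 0 < m' j) ∧
    (Monotone fun j : ℕ => ((j : ℝ) + 1) ^ (-γ) * m' j) ∧
    (∀ j : ℕ, a⁻¹ * (M (j + 1) / M j) ≤ m' j ∧ m' j ≤ a * (M (j + 1) / M j))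

noncomputable def growthIndex (M : ℕ → ℝ) : ℝ :=
  sSup {γ : ℝ | 0 < γ ∧ PropertyP M γ}

def Sector (γ : ℝ) : Set ℂ :=
  {z : ℂ | z ≠ 0 ∧ |Complex.arg z| < γ * Real.pi / 2}

noncomputable def mixedPartial {n : ℕ} {F : Type*} [NormedAddCommGroup F] [NormedSpace ℝ F]
    (S : Set (EuclideanSpace ℝ (Fin n))) (f : EuclideanSpace ℝ (Fin n) → F)
    (k : ℕ) (e : Fin k → Fin n) (x : EuclideanSpace ℝ (Fin n)) : F :=
  iteratedFDerivWithin ℝ k f S x fun i => EuclideanSpace.single (e i) 1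

/-! ### Sums of reciprocal ratios -/

lemma half_le_sum_Ico_inv (L s : ℕ) (hL : 0 < L) :
    (s : ℝ) / 2 ≤ ∑ i ∈ Finset.Ico L (2 ^ s * L), (1 : ℝ) / i := by
  induction s with
  | zero => simp
  | succ s ih =>
    have h1 : L ≤ 2 ^ s * L := Nat.le_mul_of_pos_left _ (by positivity)
    have h2 : 2 ^ s * L ≤ 2 ^ (s + 1) * L := by
      gcongr <;> omega
    rw [← Finset.sum_Ico_consecutive _ h1 h2]
    have h3 : ∑ i ∈ Finset.Ico (2 ^ s * L) (2 ^ (s + 1) * L), (1 : ℝ) / (2 ^ (s + 1) * L) ≤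
        ∑ i ∈ Finset.Ico (2 ^ s * L) (2 ^ (s + 1) * L), (1 : ℝ) / i := by
      refine Finset.sum_le_sum fun i hi => ?_
      rw [Finset.mem_Ico] at hi
      have hi0 : (0 : ℝ) < i := by
        have : 0 < 2 ^ s * L := by positivity
        exact_mod_cast lt_of_lt_of_le this hi.1
      have : (i : ℝ) ≤ 2 ^ (s + 1) * L := by exact_mod_cast hi.2.le
      exact one_div_le_one_div_of_le hi0 this
    have h4 : ∑ i ∈ Finset.Ico (2 ^ s * L) (2 ^ (s + 1) * L), (1 : ℝ) / (2 ^ (s + 1) * L) =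
        1 / 2 := by
      have hc : 2 ^ (s + 1) * L - 2 ^ s * L = 2 ^ s * L := by
        rw [pow_succ, mul_right_comm]; omega
      have hL' : (L : ℝ) ≠ 0 := by exact_mod_cast hL.ne'
      rw [Finset.sum_const, Nat.card_Ico, hc, nsmul_eq_mul]
      push_cast
      field_simp
      ring
    push_cast
    linarith

/-- If a positive sequence doubles along the dilation `ℓ + 1 ↦ N (ℓ + 1)`, then the sums of
`(m ℓ / m j) ^ p` over `j ≥ ℓ` are `O(ℓ + 1)` as soon as `2 N ≤ 2 ^ p`. -/
lemma sum_ratio_pow_le {m : ℕ → ℝ} (hpos : ∀ j, 0 < m j) (hmono : Monotone m) {N p : ℕ}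
    (hN : 2 ≤ N) (hp : 2 * N ≤ 2 ^ p) (hdouble : ∀ ℓ, 2 * m ℓ ≤ m (N * (ℓ + 1) - 1))
    (ℓ n : ℕ) :
    ∑ j ∈ Finset.Ico ℓ n, (m ℓ / m j) ^ p ≤ 2 * N * (ℓ + 1) := by
  set K : ℕ → ℕ := fun i => N ^ i * (ℓ + 1) - 1 with hK
  have hKpos : ∀ i, 0 < N ^ i * (ℓ + 1) := fun i => by positivity
  have hKs : ∀ i, K (i + 1) = N * (K i + 1) - 1 := by
    intro i
    have : K i + 1 = N ^ i * (ℓ + 1) := Nat.sub_add_cancel (hKpos i)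
    rw [this]; simp only [hK]; rw [pow_succ]; ring_nf
  have hKle : ∀ i, K i ≤ K (i + 1) := by
    intro i
    rw [hKs]
    have : 2 * (K i + 1) ≤ N * (K i + 1) := Nat.mul_le_mul_right _ hN
    omega
  have hgrow : ∀ i, 2 ^ i * m ℓ ≤ m (K i) := by
    intro i
    induction i with
    | zero => simp [hK]
    | succ i ih =>
      rw [hKs, pow_succ]
      have := hdouble (K i)
      linarith
  have hℓK : ∀ i, ℓ ≤ K i := by
    intro i
    induction i with
    | zero => simp [hK]
    | succ i ih => exact ih.trans (hKle i)
  have hpR : 2 * (N : ℝ) ≤ 2 ^ p := by exact_mod_cast hp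
  have hNR : (0 : ℝ) < N := by exact_mod_cast (by omega : 0 < N)
  have hterm : ∀ j, 0 ≤ (m ℓ / m j) ^ p := fun j =>
    pow_nonneg (div_nonneg (hpos _).le (hpos _).le) _
  have hblock : ∀ i, ∑ j ∈ Finset.Ico (K i) (K (i + 1)), (m ℓ / m j) ^ p ≤
      N * (ℓ + 1) * (1 / 2) ^ i := by
    intro i
    have h1 : ∀ j ∈ Finset.Ico (K i) (K (i + 1)), (m ℓ / m j) ^ p ≤ ((1 / (2 * N)) ^ i : ℝ) := by
      intro j hj
      rw [Finset.mem_Ico] at hj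
      have h2 : m ℓ / m j ≤ (1 / 2) ^ i := by
        rw [div_le_iff₀ (hpos j)]
        have h3 := (hgrow i).trans (hmono hj.1)
        have h4 : (1 / 2 : ℝ) ^ i * (2 ^ i * m ℓ) ≤ (1 / 2) ^ i * m j := by gcongr
        rwa [← mul_assoc, ← mul_pow, one_div_mul_cancel two_ne_zero, one_pow, one_mul] at h4
      calc (m ℓ / m j) ^ p ≤ ((1 / 2) ^ i) ^ p :=
            pow_le_pow_left₀ (div_nonneg (hpos _).le (hpos _).le) h2 p
        _ = (1 / 2 ^ p) ^ i := by rw [← pow_mul, mul_comm, pow_mul, one_div_pow]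
        _ ≤ (1 / (2 * N)) ^ i := by gcongr
    refine (Finset.sum_le_card_nsmul _ _ _ h1).trans ?_
    rw [Nat.card_Ico, nsmul_eq_mul]
    have h5 : ((K (i + 1) - K i : ℕ) : ℝ) ≤ N ^ (i + 1) * (ℓ + 1) := by
      have : K (i + 1) - K i ≤ N ^ (i + 1) * (ℓ + 1) := by simp only [hK]; omega
      exact_mod_cast this
    calc ((K (i + 1) - K i : ℕ) : ℝ) * (1 / (2 * N)) ^ i
        ≤ N ^ (i + 1) * (ℓ + 1) * (1 / (2 * N)) ^ i := by gcongr
      _ = N * (ℓ + 1) * (N * (1 / (2 * N))) ^ i := by rw [mul_pow]; ring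
      _ = N * (ℓ + 1) * (1 / 2) ^ i := by congr 2; field_simp
  have hpart : ∀ i, ∑ j ∈ Finset.Ico ℓ (K i), (m ℓ / m j) ^ p ≤
      2 * N * (ℓ + 1) * (1 - (1 / 2) ^ i) := by
    intro i
    induction i with
    | zero => simp [hK]
    | succ i ih =>
      rw [← Finset.sum_Ico_consecutive _ (hℓK i) (hKle i)]
      have := hblock i
      rw [pow_succ]
      nlinarith
  have hn : n ≤ K n := by
    have : n < N ^ n := Nat.lt_pow_self (by omega)
    have h2 : N ^ n ≤ N ^ n * (ℓ + 1) := Nat.le_mul_of_pos_right _ (by omega)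
    simp only [hK]; omega
  calc ∑ j ∈ Finset.Ico ℓ n, (m ℓ / m j) ^ p
      ≤ ∑ j ∈ Finset.Ico ℓ (K n), (m ℓ / m j) ^ p :=
        Finset.sum_le_sum_of_subset_of_nonneg (Finset.Ico_subset_Ico le_rfl hn)
          fun j _ _ => hterm j
    _ ≤ 2 * N * (ℓ + 1) * (1 - (1 / 2) ^ n) := hpart n
    _ ≤ 2 * N * (ℓ + 1) := by
      refine mul_le_of_le_one_right (by positivity) ?_
      have : (0 : ℝ) ≤ (1 / 2) ^ n := by positivity
      linarith

namespace StronglyRegularWith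

variable {M : ℕ → ℝ} {A : ℝ}

lemma ratio_pos (h : StronglyRegularWith M A) (j : ℕ) : 0 < M (j + 1) / M j :=
  div_pos (h.1 _) (h.1 _)

lemma ratio_monotone (h : StronglyRegularWith M A) : Monotone fun j => M (j + 1) / M j := by
  refine monotone_nat_of_le_succ fun j => ?_
  rw [div_le_div_iff₀ (h.1 _) (h.1 _)]
  have := h.2.2.2.1 j
  linarith

lemma prod_ratio (h : StronglyRegularWith M A) (k : ℕ) :
    ∏ j ∈ Finset.range k, M (j + 1) / M j = M k := by
  induction k with
  | zero => simp [h.2.1]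
  | succ k ih =>
    rw [Finset.prod_range_succ, ih]
    have := (h.1 k).ne'
    field_simp

lemma two_mul_ratio_le (h : StronglyRegularWith M A) {s : ℕ} (hs : 4 * A ≤ s) (ℓ : ℕ) :
    2 * (M (ℓ + 1) / M ℓ) ≤ M (2 ^ s * (ℓ + 1) - 1 + 1) / M (2 ^ s * (ℓ + 1) - 1) := by
  set m : ℕ → ℝ := fun j => M (j + 1) / M j with hm
  have hmono : Monotone m := h.ratio_monotone
  have hpos : ∀ j, 0 < m j := h.ratio_pos
  change 2 * m ℓ ≤ m (2 ^ s * (ℓ + 1) - 1)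
  set K := 2 ^ s * (ℓ + 1) - 1 with hK
  have hKK : K + 1 = 2 ^ s * (ℓ + 1) := Nat.sub_add_cancel (Nat.succ_le_of_lt (by positivity))
  have hA : 1 ≤ A := h.2.2.2.2.1
  have h1 := half_le_sum_Ico_inv (ℓ + 1) s (by omega)
  have h2 := h.2.2.2.2.2.2 ℓ (K - ℓ)
  have hℓ : ℓ + 1 ≤ 2 ^ s * (ℓ + 1) := Nat.le_mul_of_pos_left _ (by positivity)
  rw [Finset.sum_Ico_eq_sum_range, show 2 ^ s * (ℓ + 1) - (ℓ + 1) = K - ℓ by omega] at h1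
  have h3 : (∑ j ∈ Finset.range (K - ℓ), (1 : ℝ) / ((ℓ + 1 + j : ℕ))) / m K ≤
      ∑ j ∈ Finset.range (K - ℓ), M (ℓ + j) / (((ℓ + j : ℕ) + 1 : ℝ) * M (ℓ + j + 1)) := by
    rw [Finset.sum_div]
    refine Finset.sum_le_sum fun j hj => ?_
    rw [Finset.mem_range] at hj
    have e : M (ℓ + j) / (((ℓ + j : ℕ) + 1 : ℝ) * M (ℓ + j + 1)) =
        1 / ((ℓ + 1 + j : ℕ)) / m (ℓ + j) := by
      have a1 := (h.1 (ℓ + j)).ne'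
      have a2 := (h.1 (ℓ + j + 1)).ne'
      simp only [hm]
      push_cast
      field_simp
      ring
    rw [e]
    exact div_le_div_of_nonneg_left (by positivity) (hpos _) (hmono (by omega))
  have h4 : M ℓ / M (ℓ + 1) = 1 / m ℓ := by simp [hm]
  rw [h4] at h2
  have h5 : 2 * A / m K ≤ A * (1 / m ℓ) := by
    refine le_trans ?_ (h3.trans h2)
    have := hpos K
    gcongr
    linarith
  rw [mul_one_div, div_le_div_iff₀ (hpos _) (hpos _)] at h5
  nlinarith

lemma exists_sum_ratio_pow_le (h : StronglyRegularWith M A) :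
    ∃ q : ℕ, 1 ≤ q ∧ ∃ C : ℝ, 0 < C ∧ ∀ ℓ n : ℕ,
      ∑ j ∈ Finset.Ico ℓ n, ((M (ℓ + 1) / M ℓ) / (M (j + 1) / M j)) ^ (2 * q) ≤ C * (ℓ + 1) := by
  obtain ⟨s, hs⟩ := exists_nat_ge (4 * A)
  have hA : 1 ≤ A := h.2.2.2.2.1
  have hs1 : 1 ≤ s := by
    have : (1 : ℝ) ≤ s := by linarith
    exact_mod_cast this
  refine ⟨s, hs1, 2 * (2 ^ s : ℕ), by positivity, fun ℓ n => ?_⟩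
  refine sum_ratio_pow_le (m := fun j => M (j + 1) / M j) h.ratio_pos h.ratio_monotone
    ?_ ?_ (fun ℓ => h.two_mul_ratio_le hs ℓ) ℓ n
  · calc 2 = 2 ^ 1 := rfl
      _ ≤ 2 ^ s := Nat.pow_le_pow_right (by norm_num) hs1
  · rw [← pow_succ']
    exact Nat.pow_le_pow_right (by norm_num) (by omega)

lemma pow_mul_le (h : StronglyRegularWith M A) (ℓ i : ℕ) :
    M (i * ℓ) ≤ A ^ (i * i * ℓ) * M ℓ ^ i := by
  have hA : 1 ≤ A := h.2.2.2.2.1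
  induction i with
  | zero => simp [h.2.1]
  | succ i ih =>
    have hMℓ := h.1 ℓ
    calc M ((i + 1) * ℓ) = M (i * ℓ + ℓ) := by rw [add_mul, one_mul]
      _ ≤ A ^ (i * ℓ + ℓ) * (M (i * ℓ) * M ℓ) := h.2.2.2.2.2.1 _ _
      _ ≤ A ^ (i * ℓ + ℓ) * (A ^ (i * i * ℓ) * M ℓ ^ i * M ℓ) := by gcongr
      _ = A ^ (i * ℓ + ℓ + i * i * ℓ) * M ℓ ^ (i + 1) := by rw [pow_add A, pow_succ (M ℓ)]; ring
      _ ≤ A ^ ((i + 1) * (i + 1) * ℓ) * M ℓ ^ (i + 1) := by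
        gcongr
        nlinarith

end StronglyRegularWith

/-! ### An entire product with positive coefficients -/

lemma prod_range_le_prod_range_of_one_le {f : ℕ → ℝ} (hf : ∀ j, 1 ≤ f j) {k n : ℕ} (hkn : k ≤ n) :
    ∏ j ∈ Finset.range k, f j ≤ ∏ j ∈ Finset.range n, f j := by
  refine monotone_nat_of_le_succ (f := fun k => ∏ j ∈ Finset.range k, f j) (fun k => ?_) hkn
  rw [Finset.prod_range_succ]
  exact le_mul_of_one_le_right (Finset.prod_nonneg fun j _ => zero_le_one.trans (hf j)) (hf k)

/-- The product `∏ (1 + a j * w)` as an entire function, with its values on the real axis. -/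
lemma exists_entire_product {a : ℕ → ℝ} (ha : ∀ j, 0 ≤ a j) (hs : Summable a) :
    ∃ (Ψ : ℂ → ℂ) (ψ : ℝ → ℝ), Differentiable ℂ Ψ ∧ (∀ x : ℝ, Ψ x = ψ x) ∧
      (∀ w, ‖Ψ w‖ ≤ ψ ‖w‖) ∧ (∀ w : ℂ, 0 ≤ w.re → ψ w.re ≤ ‖Ψ w‖) ∧
      (∀ x, 0 ≤ x → ∀ k, ∏ j ∈ Finset.range k, (1 + a j * x) ≤ ψ x) ∧
      (∀ x B, (∀ k, ∏ j ∈ Finset.range k, (1 + a j * x) ≤ B) → ψ x ≤ B) ∧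
      MonotoneOn ψ (Set.Ici 0) := by
  have hloc : HasProdLocallyUniformlyOn (fun j (w : ℂ) => 1 + (a j : ℂ) * w)
      (fun w => ∏' j, (1 + (a j : ℂ) * w)) Set.univ := by
    refine hasProdLocallyUniformlyOn_of_forall_compact isOpen_univ fun S _ hS => ?_
    obtain ⟨R, hR⟩ := hS.isBounded.exists_norm_le
    refine Summable.hasProdUniformlyOn_nat_one_add hS (hs.mul_right R)
      (Eventually.of_forall fun j w hw => ?_) fun j => by fun_prop
    rw [norm_mul, Complex.norm_real, Real.norm_of_nonneg (ha j)]
    exact mul_le_mul_of_nonneg_left (hR w hw) (ha j)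
  have hunif := hloc.tendstoLocallyUniformlyOn_finsetRange
  set Ψ : ℂ → ℂ := fun w => ∏' j, (1 + (a j : ℂ) * w)
  have hlim : ∀ w, Tendsto (fun k => ∏ j ∈ Finset.range k, (1 + (a j : ℂ) * w)) atTop (𝓝 (Ψ w)) :=
    fun w => hunif.tendsto_at (Set.mem_univ w)
  have hreal : ∀ (x : ℝ) (k : ℕ), ∏ j ∈ Finset.range k, (1 + (a j : ℂ) * (x : ℂ)) =
      ((∏ j ∈ Finset.range k, (1 + a j * x) : ℝ) : ℂ) := fun x k => by push_cast; rfl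
  have hlimr : ∀ x : ℝ, Tendsto (fun k => ∏ j ∈ Finset.range k, (1 + a j * x)) atTop
      (𝓝 (Ψ x).re) := by
    intro x
    have := (Complex.continuous_re.tendsto _).comp (hlim x)
    simpa only [Function.comp_def, hreal, Complex.ofReal_re] using this
  have hone : ∀ x : ℝ, 0 ≤ x → ∀ j, 1 ≤ 1 + a j * x := fun x hx j =>
    le_add_of_nonneg_right (mul_nonneg (ha j) hx)
  refine ⟨Ψ, fun x => (Ψ x).re, ?_, fun x => ?_, fun w => ?_, fun w hw => ?_, fun x hx k => ?_,
    fun x B hB => ?_, fun x hx y hy hxy => ?_⟩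
  · rw [← differentiableOn_univ]
    exact hunif.differentiableOn (Eventually.of_forall fun k => by fun_prop) isOpen_univ
  · refine Complex.ext (by simp) ?_
    have := (Complex.continuous_im.tendsto _).comp (hlim x)
    simp only [Function.comp_def, hreal, Complex.ofReal_im] at this
    simpa using tendsto_nhds_unique this tendsto_const_nhds
  · refine le_of_tendsto_of_tendsto' (hlim w).norm (hlimr ‖w‖) fun k => ?_
    rw [norm_prod]
    refine Finset.prod_le_prod (fun j _ => norm_nonneg _) fun j _ => ?_
    refine (norm_add_le _ _).trans_eq ?_
    rw [norm_one, norm_mul, Complex.norm_real, Real.norm_of_nonneg (ha j)]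
  · refine le_of_tendsto_of_tendsto' (hlimr w.re) (hlim w).norm fun k => ?_
    rw [norm_prod]
    refine Finset.prod_le_prod (fun j _ => zero_le_one.trans (hone _ hw j)) fun j _ => ?_
    refine le_trans (le_of_eq ?_) (Complex.re_le_norm _)
    simp
  · refine ge_of_tendsto (hlimr x) ?_
    filter_upwards [eventually_ge_atTop k] with n hn
    exact prod_range_le_prod_range_of_one_le (hone x hx) hn
  · exact le_of_tendsto' (hlimr x) hB
  · refine le_of_tendsto_of_tendsto' (hlimr x) (hlimr y) fun k => ?_
    refine Finset.prod_le_prod (fun j _ => zero_le_one.trans (hone _ hx j)) fun j _ => ?_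
    have := ha j
    gcongr

lemma prod_one_add_le_exp_sum {ι : Type*} (s : Finset ι) {f : ι → ℝ} (hf : ∀ i ∈ s, 0 ≤ f i) :
    ∏ i ∈ s, (1 + f i) ≤ Real.exp (∑ i ∈ s, f i) := by
  rw [Real.exp_sum]
  refine Finset.prod_le_prod (fun i hi => add_nonneg zero_le_one (hf i hi)) fun i _ => ?_
  rw [add_comm]
  exact Real.add_one_le_exp _

lemma hfn_le {M : ℕ → ℝ} (hM : ∀ j, 0 < M j) {t : ℝ} (ht : 0 < t) (k : ℕ) :
    hfn M t ≤ t ^ k * M k := by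
  rw [hfn, if_neg ht.ne']
  refine ciInf_le ⟨0, ?_⟩ k
  rintro _ ⟨j, rfl⟩
  have := hM j
  positivity

lemma le_hfn {M : ℕ → ℝ} {t b : ℝ} (ht : 0 < t) (hb : ∀ k, b ≤ t ^ k * M k) : b ≤ hfn M t := by
  rw [hfn, if_neg ht.ne']
  exact le_ciInf hb

namespace StronglyRegularWith

variable {M : ℕ → ℝ} {A : ℝ}

/-- Upper bound for the partial products with zeros governed by the ratios `M (j + 1) / M j`. -/
lemma prod_one_add_le (h : StronglyRegularWith M A) {p : ℕ} {C : ℝ}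
    (hC : ∀ ℓ n : ℕ,
      ∑ j ∈ Finset.Ico ℓ n, ((M (ℓ + 1) / M ℓ) / (M (j + 1) / M j)) ^ p ≤ C * (ℓ + 1))
    {t : ℝ} (ht : 0 < t) {ℓ : ℕ} (hlt : ∀ j < ℓ, M (j + 1) / M j * t < 1)
    (hge : 1 ≤ M (ℓ + 1) / M ℓ * t) (k : ℕ) :
    ∏ j ∈ Finset.range k, (1 + (M (j + 1) / M j)⁻¹ ^ p * (t ^ p)⁻¹) ≤
      Real.exp (C * (ℓ + 1)) * 2 ^ ℓ * ((t ^ ℓ * M ℓ) ^ p)⁻¹ := by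
  set m : ℕ → ℝ := fun j => M (j + 1) / M j with hm
  have hpos : ∀ j, 0 < m j := h.ratio_pos
  change ∏ j ∈ Finset.range k, (1 + (m j)⁻¹ ^ p * (t ^ p)⁻¹) ≤ _
  have hy : ∀ j, (m j)⁻¹ ^ p * (t ^ p)⁻¹ = ((m j * t)⁻¹) ^ p := fun j => by
    rw [mul_inv, mul_pow, inv_pow t]
  simp only [hy]
  have hy0 : ∀ j, 0 ≤ ((m j * t)⁻¹) ^ p := fun j => by have := hpos j; positivity
  have h1 : ∏ j ∈ Finset.range k, (1 + ((m j * t)⁻¹) ^ p) ≤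
      ∏ j ∈ Finset.range (ℓ + k), (1 + ((m j * t)⁻¹) ^ p) :=
    prod_range_le_prod_range_of_one_le (fun j => le_add_of_nonneg_right (hy0 j)) (by omega)
  refine h1.trans ?_
  rw [Finset.range_eq_Ico, ← Finset.prod_Ico_consecutive _ (Nat.zero_le ℓ) (Nat.le_add_right ℓ k),
    ← Finset.range_eq_Ico]
  have h2 : ∏ j ∈ Finset.range ℓ, (1 + ((m j * t)⁻¹) ^ p) ≤ 2 ^ ℓ * ((t ^ ℓ * M ℓ) ^ p)⁻¹ := by
    have e : 2 ^ ℓ * ((t ^ ℓ * M ℓ) ^ p)⁻¹ = ∏ j ∈ Finset.range ℓ, (2 * ((m j * t)⁻¹) ^ p) := by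
      rw [Finset.prod_mul_distrib, Finset.prod_pow, Finset.prod_inv_distrib,
        Finset.prod_mul_distrib, h.prod_ratio]
      rw [Finset.prod_const, Finset.prod_const, Finset.card_range, inv_pow, mul_comm (M ℓ)]
    rw [e]
    refine Finset.prod_le_prod (fun j _ => add_nonneg zero_le_one (hy0 j)) fun j hj => ?_
    have hj := hlt j (Finset.mem_range.1 hj)
    have : 1 ≤ ((m j * t)⁻¹) ^ p :=
      one_le_pow₀ (one_le_inv_iff₀.2 ⟨mul_pos (hpos j) ht, hj.le⟩)
    linarith
  have h3 : ∏ j ∈ Finset.Ico ℓ (ℓ + k), (1 + ((m j * t)⁻¹) ^ p) ≤ Real.exp (C * (ℓ + 1)) := by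
    refine (prod_one_add_le_exp_sum _ fun j _ => hy0 j).trans (Real.exp_le_exp.2 ?_)
    refine (Finset.sum_le_sum fun j _ => ?_).trans (hC ℓ (ℓ + k))
    have hj := hpos j
    refine pow_le_pow_left₀ (by positivity) ?_ p
    change _ ≤ m ℓ / m j
    rw [mul_inv, mul_comm, div_eq_mul_inv]
    refine mul_le_mul_of_nonneg_right ?_ (inv_nonneg.2 hj.le)
    rwa [inv_le_iff_one_le_mul₀ ht]
  calc _ ≤ 2 ^ ℓ * ((t ^ ℓ * M ℓ) ^ p)⁻¹ * Real.exp (C * (ℓ + 1)) := by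
        refine mul_le_mul h2 h3 (Finset.prod_nonneg fun j _ => add_nonneg zero_le_one (hy0 j)) ?_
        have := h.1 ℓ
        positivity
    _ = _ := by ring

/-- An entire function `Ψ` such that `1 / Ψ (t ^ (-2 q))` is comparable to the associated
function `hfn M`, up to dilations and powers. -/
lemma exists_entire_comparable (h : StronglyRegularWith M A) :
    ∃ (q : ℕ) (Ψ : ℂ → ℂ) (ψ : ℝ → ℝ) (B D : ℝ), 1 ≤ q ∧ 0 < B ∧ 0 < D ∧
      Differentiable ℂ Ψ ∧ (∀ x : ℝ, Ψ x = ψ x) ∧ (∀ w, ‖Ψ w‖ ≤ ψ ‖w‖) ∧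
      (∀ w : ℂ, 0 ≤ w.re → ψ w.re ≤ ‖Ψ w‖) ∧ MonotoneOn ψ (Set.Ici 0) ∧
      (∀ x, 0 ≤ x → 1 ≤ ψ x) ∧
      (∀ t, 0 < t → ∀ k, 1 ≤ ψ ((t ^ (2 * q))⁻¹) * (t ^ k * M k)) ∧
      (∀ t, 0 < t → 0 < hfn M t) ∧
      (∀ t, 0 < t → ψ ((t ^ (2 * q))⁻¹) ^ 2 * hfn M (t / B) ≤ D) := by
  obtain ⟨q, hq, C, hC0, hC⟩ := h.exists_sum_ratio_pow_le
  set p := 2 * q with hp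
  have hp1 : 1 ≤ p := by omega
  have hA : 1 ≤ A := h.2.2.2.2.1
  set m : ℕ → ℝ := fun j => M (j + 1) / M j with hm
  have hpos : ∀ j, 0 < m j := h.ratio_pos
  have ha : ∀ j, 0 ≤ (m j)⁻¹ ^ p := fun j => by have := hpos j; positivity
  have hs : Summable fun j => (m j)⁻¹ ^ p := by
    refine summable_of_sum_range_le (c := C * ((0 : ℕ) + 1) / (m 0) ^ p) ha fun n => ?_
    have h0 := hC 0 n
    have hm0 := hpos 0
    rw [le_div_iff₀ (by positivity), Finset.sum_mul]
    refine le_trans (le_of_eq ?_) h0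
    rw [Finset.range_eq_Ico]
    refine Finset.sum_congr rfl fun j _ => ?_
    change _ = (m 0 / m j) ^ p
    rw [← mul_pow, mul_comm, div_eq_mul_inv]
  obtain ⟨Ψ, ψ, hd, hre, hup, hlow, hge, hle, hmono⟩ := exists_entire_product ha hs
  have hone : ∀ x, 0 ≤ x → 1 ≤ ψ x := fun x hx => by simpa using hge x hx 0
  have hlower : ∀ t, 0 < t → ∀ k, 1 ≤ ψ ((t ^ p)⁻¹) * (t ^ k * M k) := by
    intro t ht k
    have hMk := h.1 k
    rw [← div_le_iff₀ (by positivity)]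
    refine le_trans ?_ (hge _ (by positivity) k)
    have e : 1 / (t ^ k * M k) = ∏ j ∈ Finset.range k, (m j * t)⁻¹ := by
      rw [Finset.prod_inv_distrib, Finset.prod_mul_distrib, h.prod_ratio]
      simp [mul_comm]
    rw [e]
    refine Finset.prod_le_prod (fun j _ => by have := hpos j; positivity) fun j _ => ?_
    have hj := hpos j
    rw [← inv_pow, ← mul_pow, ← mul_inv]
    have hx : 0 ≤ (m j * t)⁻¹ := by positivity
    rcases le_total (m j * t)⁻¹ 1 with h1 | h1
    · exact h1.trans (le_add_of_nonneg_right (by positivity))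
    · exact (le_self_pow₀ h1 (by omega)).trans (le_add_of_nonneg_left zero_le_one)
  have hψpos : ∀ t : ℝ, 0 < t → 0 < ψ ((t ^ p)⁻¹) := fun t ht =>
    zero_lt_one.trans_le (hone _ (by positivity))
  set B := Real.exp (2 * C) * 4 * A ^ (2 * p * (2 * p)) with hB
  have hB0 : 0 < B := by positivity
  have hB1 : 1 ≤ B := by
    have h1 : 1 ≤ Real.exp (2 * C) := Real.one_le_exp (by positivity)
    have h2 : 1 ≤ A ^ (2 * p * (2 * p)) := one_le_pow₀ hA
    have h3 : 1 ≤ Real.exp (2 * C) * 4 := by linarith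
    exact one_le_mul_of_one_le_of_one_le h3 h2
  refine ⟨q, Ψ, ψ, B, Real.exp (2 * C), hq, hB0, by positivity, hd, hre, hup, hlow, hmono, hone,
    hlower, fun t ht => ?_, fun t ht => ?_⟩
  · have hψ := hψpos t ht
    refine (inv_pos.2 hψ).trans_le (le_hfn ht fun k => ?_)
    rw [inv_le_iff_one_le_mul₀ hψ, mul_comm]
    exact hlower t ht k
  · have hex : ∃ j, 1 ≤ m j * t := by
      have := (hs.tendsto_atTop_zero.eventually (gt_mem_nhds (pow_pos ht p))).exists
      obtain ⟨j, hj⟩ := this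
      refine ⟨j, ?_⟩
      have := (lt_of_pow_lt_pow_left₀ p ht.le hj).le
      rwa [inv_le_iff_one_le_mul₀ (hpos j), mul_comm] at this
    classical
    obtain ⟨ℓ, hge', hlt⟩ : ∃ ℓ, 1 ≤ m ℓ * t ∧ ∀ j < ℓ, m j * t < 1 :=
      ⟨Nat.find hex, Nat.find_spec hex, fun j hj => not_le.1 (Nat.find_min hex hj)⟩
    have hMℓ := h.1 ℓ
    have h1 : ψ ((t ^ p)⁻¹) ≤ Real.exp (C * (ℓ + 1)) * 2 ^ ℓ * ((t ^ ℓ * M ℓ) ^ p)⁻¹ :=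
      hle _ _ fun k => h.prod_one_add_le hC ht hlt hge' k
    have h2 : hfn M (t / B) ≤ (t / B) ^ (2 * p * ℓ) * (A ^ (2 * p * (2 * p) * ℓ) * M ℓ ^ (2 * p)) :=
      (hfn_le h.1 (by positivity) _).trans
        (mul_le_mul_of_nonneg_left (h.pow_mul_le ℓ (2 * p)) (by positivity))
    calc ψ ((t ^ p)⁻¹) ^ 2 * hfn M (t / B)
        ≤ (Real.exp (C * (ℓ + 1)) * 2 ^ ℓ * ((t ^ ℓ * M ℓ) ^ p)⁻¹) ^ 2 *
          ((t / B) ^ (2 * p * ℓ) * (A ^ (2 * p * (2 * p) * ℓ) * M ℓ ^ (2 * p))) := by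
          have := (hψpos t ht).le
          refine mul_le_mul (pow_le_pow_left₀ this h1 2) h2 ?_ (by positivity)
          exact le_hfn (by positivity) fun k => by have := h.1 k; positivity
      _ = Real.exp (2 * C) * (B / B ^ (2 * p)) ^ ℓ := by
          have e1 : Real.exp (C * (ℓ + 1)) ^ 2 = Real.exp (2 * C) * Real.exp (2 * C) ^ ℓ := by
            rw [← Real.exp_nat_mul, ← Real.exp_nat_mul, ← Real.exp_add]
            congr 1; push_cast; ring
          have e2 : (B / B ^ (2 * p)) ^ ℓ =
              Real.exp (2 * C) ^ ℓ * (2 ^ ℓ) ^ 2 * A ^ (2 * p * (2 * p) * ℓ) /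
                B ^ (2 * p * ℓ) := by
            rw [div_pow, ← pow_mul, hB, mul_pow, mul_pow, ← pow_mul A, ← pow_mul 2, mul_comm ℓ 2,
              pow_mul 2 2 ℓ]
            norm_num
          have e3 : (((t ^ ℓ * M ℓ) ^ p)⁻¹) ^ 2 = (t ^ (2 * p * ℓ) * M ℓ ^ (2 * p))⁻¹ := by
            rw [inv_pow, ← pow_mul, mul_pow, ← pow_mul]
            congr 3 <;> ring
          rw [e2, mul_pow, mul_pow, e1, e3, div_pow]
          field_simp
      _ ≤ Real.exp (2 * C) := by
          refine mul_le_of_le_one_right (by positivity) (pow_le_one₀ (by positivity) ?_)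
          rw [div_le_one (by positivity)]
          exact le_self_pow₀ hB1 (by omega)

end StronglyRegularWith

/-! ### Polarization -/

lemma sum_neg_one_pow_card_of_forall_mem {k : ℕ} (r : Fin k → Fin k) :
    ∑ S : Finset (Fin k), (if ∀ i, r i ∈ S then (-1 : ℝ) ^ S.card else 0) =
      if Function.Bijective r then (-1) ^ k else 0 := by
  classical
  set g : Fin k → ℝ := fun j => if j ∈ Set.range r then 0 else 1 with hg
  have h1 : ∏ j : Fin k, (-1 + g j) = ∑ S : Finset (Fin k),
      (if ∀ i, r i ∈ S then (-1 : ℝ) ^ S.card else 0) := by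
    rw [Finset.prod_add, Finset.powerset_univ]
    refine Finset.sum_congr rfl fun S _ => ?_
    rw [Finset.prod_const]
    split_ifs with h
    · rw [Finset.prod_eq_one, mul_one]
      intro j hj
      simp only [hg]
      rw [if_neg]
      rintro ⟨i, rfl⟩
      exact (Finset.mem_sdiff.1 hj).2 (h i)
    · push Not at h
      obtain ⟨i, hi⟩ := h
      rw [Finset.prod_eq_zero (i := r i) (by simp [hi]) (by simp [hg]), mul_zero]
  rw [← h1]
  split_ifs with h
  · simp [hg, h.2 _]
  · rw [← Finite.surjective_iff_bijective, Function.Surjective] at h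
    push Not at h
    obtain ⟨j, hj⟩ := h
    refine Finset.prod_eq_zero (Finset.mem_univ j) ?_
    simp [hg, hj]

/-- The polarization formula for symmetric multilinear maps. -/
lemma MultilinearMap.polarization {E : Type*} [AddCommGroup E] [Module ℝ E] {k : ℕ}
    (f : MultilinearMap ℝ (fun _ : Fin k => E) ℝ) (v : Fin k → E)
    (hf : ∀ σ : Equiv.Perm (Fin k), f (v ∘ σ) = f v) :
    ∑ S : Finset (Fin k), (-1 : ℝ) ^ S.card * f (fun _ => ∑ i ∈ S, v i) =
      (-1) ^ k * (k.factorial * f v) := by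
  classical
  have h1 : ∀ S : Finset (Fin k), (-1 : ℝ) ^ S.card * f (fun _ => ∑ i ∈ S, v i) =
      ∑ r : Fin k → Fin k, (if ∀ i, r i ∈ S then (-1 : ℝ) ^ S.card else 0) * f (v ∘ r) := by
    intro S
    rw [f.map_sum_finset (fun _ => v) (fun _ => S), Finset.mul_sum]
    simp only [ite_mul, zero_mul]
    rw [← Finset.sum_filter]
    refine Finset.sum_congr ?_ fun _ _ => rfl
    ext r
    simp [Fintype.mem_piFinset]
  simp only [h1]
  rw [Finset.sum_comm]
  simp only [← Finset.sum_mul, sum_neg_one_pow_card_of_forall_mem]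
  simp only [ite_mul, zero_mul]
  rw [← Finset.sum_filter, ← Finset.mul_sum]
  congr 1
  calc ∑ r : Fin k → Fin k with Function.Bijective r, f (v ∘ r)
      = ∑ σ : Equiv.Perm (Fin k), f (v ∘ σ) :=
        Finset.sum_bij (fun p h => Equiv.ofBijective p (Finset.mem_filter.1 h).2)
          (fun _ _ => Finset.mem_univ _) (fun _ _ _ _ h => by injection h)
          (fun b _ => ⟨b, Finset.mem_filter.2 ⟨Finset.mem_univ _, b.bijective⟩,
            DFunLike.coe_injective rfl⟩) fun _ _ => rfl
    _ = k.factorial * f v := by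
      simp [hf, Fintype.card_perm]

/-- A symmetric multilinear form is controlled by its values on the diagonal. -/
lemma ContinuousMultilinearMap.opNorm_le_of_diagonal {E : Type*} [NormedAddCommGroup E]
    [NormedSpace ℝ E] {k : ℕ} (f : ContinuousMultilinearMap ℝ (fun _ : Fin k => E) ℝ)
    (hf : ∀ v (σ : Equiv.Perm (Fin k)), f (v ∘ σ) = f v) {D : ℝ}
    (hD : ∀ u, ‖u‖ ≤ 1 → ‖f fun _ => u‖ ≤ D) :
    ‖f‖ ≤ D * (2 * Real.exp 1) ^ k := by
  have hscale : ∀ (c : Fin k → ℝ) (u : Fin k → E),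
      f (fun i => c i • u i) = (∏ i, c i) * f u := fun c u => by
    rw [f.map_smul_univ, smul_eq_mul]
  have hD0 : 0 ≤ D := (norm_nonneg _).trans (hD 0 (by simp))
  have hdiag : ∀ u, ‖f fun _ => u‖ ≤ D * ‖u‖ ^ k := by
    intro u
    have h1 : (fun _ : Fin k => u) = fun _ => ‖u‖ • (‖u‖⁻¹ • u) := by
      funext _
      by_cases hu : u = 0
      · simp [hu]
      · rw [smul_inv_smul₀ (norm_ne_zero_iff.2 hu)]
    rw [h1, hscale, Finset.prod_const, Finset.card_univ, Fintype.card_fin, norm_mul, norm_pow,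
      norm_norm, mul_comm]
    refine mul_le_mul_of_nonneg_right (hD _ ?_) (by positivity)
    rw [norm_smul, norm_inv, norm_norm]
    exact inv_mul_le_one
  have hunit : ∀ v : Fin k → E, (∀ i, ‖v i‖ ≤ 1) → ‖f v‖ ≤ D * (2 * Real.exp 1) ^ k := by
    intro v hv
    have hpol := f.toMultilinearMap.polarization v (hf v)
    have hk : (0 : ℝ) < k.factorial := by exact_mod_cast k.factorial_pos
    have h1 : k.factorial * ‖f v‖ ≤ 2 ^ k * (D * k ^ k) := by
      calc k.factorial * ‖f v‖ = ‖(-1 : ℝ) ^ k * (k.factorial * f v)‖ := by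
            rw [norm_mul, norm_mul, norm_pow, norm_neg, norm_one, one_pow, one_mul,
              Real.norm_of_nonneg hk.le]
        _ = ‖∑ S : Finset (Fin k), (-1 : ℝ) ^ S.card * f (fun _ => ∑ i ∈ S, v i)‖ := by
            rw [← ContinuousMultilinearMap.coe_coe, ← hpol]
        _ ≤ ∑ S : Finset (Fin k), D * k ^ k := by
            refine norm_sum_le_of_le _ fun S _ => ?_
            rw [norm_mul, norm_pow, norm_neg, norm_one, one_pow, one_mul]
            refine (hdiag _).trans (mul_le_mul_of_nonneg_left ?_ hD0)
            refine pow_le_pow_left₀ (norm_nonneg _) ?_ k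
            refine (norm_sum_le_of_le (n := fun _ => (1 : ℝ)) S fun i _ => hv i).trans ?_
            rw [Finset.sum_const, nsmul_eq_mul, mul_one]
            exact_mod_cast (Finset.card_le_univ S).trans_eq (Fintype.card_fin k)
        _ = 2 ^ k * (D * k ^ k) := by
            rw [Finset.sum_const, Finset.card_univ, Fintype.card_finset, Fintype.card_fin,
              nsmul_eq_mul]
            push_cast
            ring
    have h2 : (k : ℝ) ^ k ≤ k.factorial * Real.exp 1 ^ k := by
      have := Real.pow_div_factorial_le_exp _ (Nat.cast_nonneg k) k
      rw [div_le_iff₀ hk] at this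
      rw [← Real.exp_nat_mul, mul_one, mul_comm]
      exact this
    refine le_of_mul_le_mul_left (h1.trans ?_) hk
    calc 2 ^ k * (D * (k : ℝ) ^ k) ≤ 2 ^ k * (D * (k.factorial * Real.exp 1 ^ k)) := by gcongr
      _ = k.factorial * (D * (2 * Real.exp 1) ^ k) := by rw [mul_pow]; ring
  refine f.opNorm_le_bound (by positivity) fun v => ?_
  have h1 : v = fun i => ‖v i‖ • (‖v i‖⁻¹ • v i) := by
    funext i
    by_cases hu : v i = 0
    · simp [hu]
    · rw [smul_inv_smul₀ (norm_ne_zero_iff.2 hu)]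
  have h2 : ‖f fun i => ‖v i‖⁻¹ • v i‖ ≤ D * (2 * Real.exp 1) ^ k := by
    refine hunit _ fun i => ?_
    rw [norm_smul, norm_inv, norm_norm]
    exact inv_mul_le_one
  calc ‖f v‖ = ‖f fun i => ‖v i‖ • (‖v i‖⁻¹ • v i)‖ := by rw [← h1]
    _ = (∏ i, ‖v i‖) * ‖f fun i => ‖v i‖⁻¹ • v i‖ := by
      rw [hscale, norm_mul, Real.norm_of_nonneg (Finset.prod_nonneg fun i _ => norm_nonneg _)]
    _ ≤ (∏ i, ‖v i‖) * (D * (2 * Real.exp 1) ^ k) :=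
      mul_le_mul_of_nonneg_left h2 (Finset.prod_nonneg fun i _ => norm_nonneg _)
    _ = _ := mul_comm _ _

/-! ### Cauchy estimates along complexified lines -/

lemma iteratedFDeriv_diagonal_eq_iteratedDeriv {E : Type*} [NormedAddCommGroup E]
    [NormedSpace ℝ E] {f : E → ℝ} {x u : E} (hf : ContDiffAt ℝ ⊤ f x) {R : ℝ} (hR : 0 < R)
    {g : ℂ → ℂ} (hg : DifferentiableOn ℂ g (Metric.ball 0 R))
    (hfg : ∀ t : ℝ, |t| < R → g t = f (x + t • u)) (k : ℕ) :
    ∀ᶠ t : ℝ in 𝓝 0,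
      ((iteratedFDeriv ℝ k f (x + t • u) fun _ => u : ℝ) : ℂ) = iteratedDeriv k g t := by
  have hball : ∀ᶠ t : ℝ in 𝓝 0, |t| < R := by
    filter_upwards [Metric.ball_mem_nhds (0 : ℝ) hR] with t ht
    simpa using ht
  have hline : Tendsto (fun t : ℝ => x + t • u) (𝓝 0) (𝓝 x) := by
    have : Continuous fun t : ℝ => x + t • u := by fun_prop
    simpa using this.tendsto 0
  have hcd := hline.eventually (hf.eventually (by simp))
  have hgan : AnalyticOnNhd ℂ g (Metric.ball 0 R) := hg.analyticOnNhd Metric.isOpen_ball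
  induction k with
  | zero =>
    filter_upwards [hball] with t ht
    simp [hfg t ht]
  | succ k ih =>
    filter_upwards [ih.eventually_nhds, hball, hcd] with t h1 h2 h3
    have hmem : (t : ℂ) ∈ Metric.ball (0 : ℂ) R := by simpa using h2
    have d1 : HasDerivAt (fun s : ℝ => iteratedDeriv k g s) (iteratedDeriv (k + 1) g t) t := by
      have h4 : AnalyticAt ℂ (iteratedDeriv k g) t := by
        rw [iteratedDeriv_eq_iterate]
        exact (hgan _ hmem).iterated_deriv k
      rw [iteratedDeriv_succ]
      exact h4.differentiableAt.hasDerivAt.comp_ofReal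
    have d2 : HasDerivAt (fun s : ℝ => iteratedFDeriv ℝ k f (x + s • u) fun _ => u)
        (iteratedFDeriv ℝ (k + 1) f (x + t • u) fun _ => u) t := by
      have h5 : HasFDerivAt (iteratedFDeriv ℝ k f)
          (fderiv ℝ (iteratedFDeriv ℝ k f) (x + t • u)) (x + t • u) :=
        (h3.differentiableAt_iteratedFDeriv (WithTop.coe_lt_top _)).hasFDerivAt
      have h6 : HasDerivAt (fun s : ℝ => x + s • u) u t := by
        simpa using ((hasDerivAt_id t).smul_const u).const_add x
      have h7 := ((ContinuousMultilinearMap.apply ℝ (fun _ : Fin k => E) ℝ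
        fun _ => u).hasFDerivAt.comp_hasDerivAt t (h5.comp_hasDerivAt t h6))
      exact h7
    have d3 := d2.ofReal_comp.congr_of_eventuallyEq (h1.mono fun _ h => h.symm)
    exact d3.unique d1

/-- Cauchy estimates for a real-analytic function all of whose restrictions to lines through `x`
extend holomorphically to a disc of radius `R`, with the same bound. -/
lemma norm_iteratedFDeriv_le_of_complex_lines {E : Type*} [NormedAddCommGroup E]
    [NormedSpace ℝ E] {f : E → ℝ} {x : E} (hf : ContDiffAt ℝ ⊤ f x) {R B : ℝ} (hR : 0 < R)
    (hline : ∀ u : E, ‖u‖ ≤ 1 → ∃ g : ℂ → ℂ, DiffContOnCl ℂ g (Metric.ball 0 R) ∧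
      (∀ z ∈ Metric.sphere (0 : ℂ) R, ‖g z‖ ≤ B) ∧
      ∀ t : ℝ, |t| < R → g t = f (x + t • u)) (k : ℕ) :
    ‖iteratedFDeriv ℝ k f x‖ ≤ k.factorial * B / R ^ k * (2 * Real.exp 1) ^ k := by
  refine ContinuousMultilinearMap.opNorm_le_of_diagonal _
    (fun v σ => hf.iteratedFDeriv_comp_perm v σ) fun u hu => ?_
  obtain ⟨g, hg, hB, hfg⟩ := hline u hu
  have h1 := (iteratedFDeriv_diagonal_eq_iteratedDeriv hf hR hg.differentiableOn hfg
    k).self_of_nhds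
  have h2 := Complex.norm_iteratedDeriv_le_of_forall_mem_sphere_norm_le k hR hg hB
  rw [Complex.ofReal_zero, zero_smul, add_zero] at h1
  rwa [← h1, Complex.norm_real] at h2

/-! ### Extension by zero of a function flat on a closed set -/

/-- A function vanishing on a set `V`, smooth off `V`, and whose derivatives are
`O(‖y - x‖ ^ 2)` for `x ∈ V`, is smooth and flat on `V`. -/
lemma contDiff_of_flat {E : Type*} [NormedAddCommGroup E] [NormedSpace ℝ E] {V : Set E}
    {v : E → ℝ} (hzero : ∀ x ∈ V, v x = 0) (hsmooth : ∀ x ∉ V, ContDiffAt ℝ ⊤ v x)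
    (hbound : ∀ k : ℕ, ∃ C : ℝ, 0 ≤ C ∧ ∀ x ∈ V, ∀ y ∉ V,
      ‖iteratedFDeriv ℝ k v y‖ ≤ C * ‖y - x‖ ^ 2) :
    ContDiff ℝ (⊤ : ℕ∞) v ∧ ∀ x ∈ V, ∀ k : ℕ, iteratedFDeriv ℝ k v x = 0 := by
  have hderiv : ∀ k : ℕ, (∀ x ∈ V, iteratedFDeriv ℝ k v x = 0) →
      ∀ x ∈ V, HasFDerivAt (iteratedFDeriv ℝ k v)
        (0 : E →L[ℝ] ContinuousMultilinearMap ℝ (fun _ : Fin k => E) ℝ) x := by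
    intro k hk x hx
    obtain ⟨C, hC0, hC⟩ := hbound k
    refine HasFDerivAt.of_isLittleO ?_
    have h1 : (fun y => iteratedFDeriv ℝ k v y) =O[𝓝 x] fun y => ‖y - x‖ ^ 2 := by
      refine Asymptotics.IsBigO.of_bound C (Eventually.of_forall fun y => ?_)
      rw [norm_pow, norm_norm]
      by_cases hy : y ∈ V
      · rw [hk y hy, norm_zero]
        positivity
      · exact hC x hx y hy
    simp only [hk x hx, sub_zero, zero_apply]
    refine h1.trans_isLittleO ?_
    have h2 := (Asymptotics.isLittleO_norm_pow_id (E' := E) one_lt_two).comp_tendsto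
      (show Tendsto (fun y => y - x) (𝓝 x) (𝓝 0) from by
        have : Continuous fun y : E => y - x := by fun_prop
        simpa using this.tendsto x)
    exact h2
  have hflat : ∀ k : ℕ, ∀ x ∈ V, iteratedFDeriv ℝ k v x = 0 := by
    intro k
    induction k with
    | zero =>
      intro x hx
      ext m
      simp [hzero x hx]
    | succ k ih =>
      intro x hx
      ext m
      rw [iteratedFDeriv_succ_apply_left, (hderiv k ih x hx).fderiv]
      simp
  refine ⟨contDiff_of_differentiable_iteratedFDeriv fun k _ x => ?_, fun x hx k => hflat k x hx⟩
  by_cases hx : x ∈ V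
  · exact (hderiv k (hflat k) x hx).differentiableAt
  · exact (hsmooth x hx).differentiableAt_iteratedFDeriv (WithTop.coe_lt_top _)

/-! ### Composition with a quadratic form -/

section Quadratic

open scoped InnerProductSpace

variable {E : Type*} [NormedAddCommGroup E] [InnerProductSpace ℝ E]

lemma exists_forall_inv_one_add_pow_close (q : ℕ) :
    ∃ δ : ℝ, 0 < δ ∧ ∀ η : ℂ, ‖η‖ ≤ δ → ‖((1 + η) ^ q)⁻¹ - 1‖ ≤ 1 / 2 := by
  have hc : ContinuousAt (fun η : ℂ => ((1 + η) ^ q)⁻¹) 0 :=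
    ContinuousAt.inv₀ (by fun_prop) (by simp)
  obtain ⟨δ, hδ, h⟩ := Metric.continuousAt_iff.1 hc (1 / 2) (by norm_num)
  refine ⟨δ / 2, by positivity, fun η hη => ?_⟩
  have := h (x := η) (by rw [dist_zero_right]; linarith)
  simpa [dist_eq_norm] using this.le

/-- The complexified quadratic polynomial `z ↦ ‖a + z b‖ ^ 2` stays close to `‖a‖ ^ 2`. -/
lemma norm_complex_quadratic_sub_le {a b : E} {τ ε : ℝ} (hb : ‖b‖ ≤ τ) (hε1 : ε ≤ 1)
    {z : ℂ} (hz : ‖z‖ * τ ≤ ε * ‖a‖) :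
    ‖2 * z * (⟪a, b⟫_ℝ : ℂ) + z ^ 2 * ((‖b‖ ^ 2 : ℝ) : ℂ)‖ ≤ 3 * ε * ‖a‖ ^ 2 := by
  have hz' : ‖z‖ * ‖b‖ ≤ ε * ‖a‖ := (mul_le_mul_of_nonneg_left hb (norm_nonneg z)).trans hz
  have h0 : 0 ≤ ‖z‖ * ‖b‖ := by positivity
  have h1 : ‖2 * z * (⟪a, b⟫_ℝ : ℂ)‖ ≤ 2 * (‖z‖ * ‖b‖) * ‖a‖ := by
    rw [norm_mul, norm_mul, Complex.norm_real, Complex.norm_ofNat]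
    have := mul_le_mul_of_nonneg_left (norm_inner_le_norm (𝕜 := ℝ) a b)
      (show 0 ≤ 2 * ‖z‖ by positivity)
    linarith
  have h2 : ‖z ^ 2 * ((‖b‖ ^ 2 : ℝ) : ℂ)‖ = (‖z‖ * ‖b‖) * (‖z‖ * ‖b‖) := by
    rw [norm_mul, norm_pow, Complex.norm_real, norm_pow, norm_norm]
    ring
  have h3 : (‖z‖ * ‖b‖) * (‖z‖ * ‖b‖) ≤ (ε * ‖a‖) * ‖a‖ := by
    refine mul_le_mul hz' (hz'.trans ?_) h0 (h0.trans hz')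
    exact mul_le_of_le_one_left (norm_nonneg a) hε1
  have h4 : (‖z‖ * ‖b‖) * ‖a‖ ≤ (ε * ‖a‖) * ‖a‖ :=
    mul_le_mul_of_nonneg_right hz' (norm_nonneg a)
  refine (norm_add_le _ _).trans ?_
  rw [h2]
  nlinarith

/-- Derivative bounds for `ψ (‖T x‖ ^ (-2 q))` and its reciprocal, when `ψ` extends to an entire
function `Ψ` which is controlled from both sides by `ψ`. -/
lemma exists_iteratedFDeriv_bounds {q : ℕ} (hq : 1 ≤ q) {Ψ : ℂ → ℂ} {ψ : ℝ → ℝ}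
    (hd : Differentiable ℂ Ψ) (hre : ∀ x : ℝ, Ψ x = ψ x) (hup : ∀ w, ‖Ψ w‖ ≤ ψ ‖w‖)
    (hlow : ∀ w : ℂ, 0 ≤ w.re → ψ w.re ≤ ‖Ψ w‖) (hmono : MonotoneOn ψ (Set.Ici 0))
    (hone : ∀ x, 0 ≤ x → 1 ≤ ψ x) :
    ∃ c : ℝ, 0 < c ∧ ∀ (T : E →L[ℝ] E) (τ : ℝ), 0 < τ → (∀ u, ‖T u‖ ≤ τ * ‖u‖) →
      ∀ x, T x ≠ 0 →
        ContDiffAt ℝ ⊤ (fun y => ψ ((‖T y‖ ^ (2 * q))⁻¹)) x ∧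
        ∀ k : ℕ,
          ‖iteratedFDeriv ℝ k (fun y => ψ ((‖T y‖ ^ (2 * q))⁻¹)) x‖ ≤
            k.factorial * (c * τ / ‖T x‖) ^ k * ψ (((‖T x‖ / 2) ^ (2 * q))⁻¹) ∧
          ‖iteratedFDeriv ℝ k (fun y => (ψ ((‖T y‖ ^ (2 * q))⁻¹))⁻¹) x‖ ≤
            k.factorial * (c * τ / ‖T x‖) ^ k * (ψ (((2 * ‖T x‖) ^ (2 * q))⁻¹))⁻¹ := by
  obtain ⟨δ, hδ, hclose⟩ := exists_forall_inv_one_add_pow_close q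
  set ε := min 1 (δ / 3) with hε
  have hε0 : 0 < ε := lt_min one_pos (by positivity)
  have hε1 : ε ≤ 1 := min_le_left _ _
  have hε3 : 3 * ε ≤ δ := by have := min_le_right 1 (δ / 3); linarith
  refine ⟨2 * Real.exp 1 / ε, by positivity, fun T τ hτ hT x hx => ?_⟩
  set ρ := ‖T x‖ with hρ
  have hρ0 : 0 < ρ := norm_pos_iff.2 hx
  have hcd : ContDiffAt ℝ ⊤ (fun y => ψ ((‖T y‖ ^ (2 * q))⁻¹)) x := by
    have e : (fun y => ψ ((‖T y‖ ^ (2 * q))⁻¹)) =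
        fun y => (Ψ ((((‖T y‖ ^ 2) ^ q)⁻¹ : ℝ) : ℂ)).re := by
      funext y
      rw [hre, Complex.ofReal_re, pow_mul]
    rw [e]
    have h1 : ContDiffAt ℝ ⊤ (fun y => ((‖T y‖ ^ 2) ^ q)⁻¹) x :=
      ((T.contDiff.norm_sq ℝ).pow q).contDiffAt.inv (by positivity)
    have h2 : ContDiff ℝ ⊤ Ψ := hd.contDiff.restrict_scalars ℝ
    exact Complex.reCLM.contDiff.contDiffAt.comp x
      (h2.contDiffAt.comp x (Complex.ofRealCLM.contDiff.contDiffAt.comp x h1))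
  have hpsipos : ∀ y, 0 ≤ y → 0 < ψ y := fun y hy => zero_lt_one.trans_le (hone y hy)
  refine ⟨hcd, fun k => ?_⟩
  set R := ε * ρ / τ with hR
  have hR0 : 0 < R := by positivity
  set s : E → ℂ → ℂ := fun u z => ((ρ ^ 2 : ℝ) : ℂ) +
    (2 * z * (⟪T x, T u⟫_ℝ : ℂ) + z ^ 2 * ((‖T u‖ ^ 2 : ℝ) : ℂ)) with hs
  have hreal : ∀ u (t : ℝ), ((s u t ^ q)⁻¹ : ℂ) = (((‖T (x + t • u)‖ ^ (2 * q))⁻¹ : ℝ) : ℂ) := by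
    intro u t
    have : s u t = ((‖T (x + t • u)‖ ^ 2 : ℝ) : ℂ) := by
      rw [map_add, map_smul, norm_add_sq_real, norm_smul, inner_smul_right, mul_pow,
        Real.norm_eq_abs, sq_abs]
      simp only [hs]
      push_cast
      ring
    rw [this, pow_mul]
    push_cast
    rfl
  have hkey : ∀ u, ‖u‖ ≤ 1 → ∀ z ∈ Metric.closedBall (0 : ℂ) R,
      s u z ≠ 0 ∧ ‖(s u z ^ q)⁻¹‖ ≤ ((ρ / 2) ^ (2 * q))⁻¹ ∧
        ((2 * ρ) ^ (2 * q))⁻¹ ≤ ((s u z ^ q)⁻¹).re := by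
    intro u hu z hz
    rw [mem_closedBall_zero_iff] at hz
    have hTu : ‖T u‖ ≤ τ := (hT u).trans (mul_le_of_le_one_right hτ.le hu)
    have h1 := norm_complex_quadratic_sub_le (a := T x) hTu hε1 (z := z)
      (by rwa [hR, le_div_iff₀ hτ] at hz)
    set Q := 2 * z * (⟪T x, T u⟫_ℝ : ℂ) + z ^ 2 * ((‖T u‖ ^ 2 : ℝ) : ℂ)
    set η := Q / ((ρ ^ 2 : ℝ) : ℂ) with hη
    have hρC : ((ρ ^ 2 : ℝ) : ℂ) ≠ 0 := by exact_mod_cast (pow_pos hρ0 2).ne'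
    have hsη : s u z = ((ρ ^ 2 : ℝ) : ℂ) * (1 + η) := by
      rw [hη, mul_add, mul_one, mul_div_cancel₀ _ hρC]
    have hηn : ‖η‖ ≤ δ := by
      rw [hη, norm_div, Complex.norm_real, Real.norm_of_nonneg (by positivity),
        div_le_iff₀ (by positivity)]
      exact h1.trans (mul_le_mul_of_nonneg_right hε3 (by positivity))
    have h2 := hclose η hηn
    set ω := ((1 + η) ^ q)⁻¹ with hω
    have hinv : (s u z ^ q)⁻¹ = (((ρ ^ (2 * q))⁻¹ : ℝ) : ℂ) * ω := by
      rw [hsη, mul_pow, mul_inv, pow_mul ρ]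
      push_cast
      rfl
    have hωn : ‖ω‖ ≤ 2 := by
      have := norm_le_norm_add_norm_sub' ω 1
      rw [norm_one] at this
      linarith
    have hωre : 1 / 2 ≤ ω.re := by
      have h3 := (Complex.abs_re_le_norm (ω - 1)).trans h2
      rw [Complex.sub_re, Complex.one_re] at h3
      linarith [(abs_le.1 h3).1]
    have h4 : (2 : ℝ) ≤ 2 ^ (2 * q) := le_self_pow₀ (by norm_num) (by omega)
    refine ⟨?_, ?_, ?_⟩
    · rw [hsη]
      refine mul_ne_zero hρC fun h0 => ?_
      rw [hω, h0, zero_pow (by omega), inv_zero, Complex.zero_re] at hωre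
      norm_num at hωre
    · rw [hinv, norm_mul, Complex.norm_real, Real.norm_of_nonneg (by positivity), div_pow,
        inv_div, div_eq_mul_inv, mul_comm]
      exact mul_le_mul_of_nonneg_right (hωn.trans h4) (by positivity)
    · rw [hinv, Complex.re_ofReal_mul, mul_pow, mul_inv, mul_comm]
      refine mul_le_mul_of_nonneg_left (le_trans ?_ hωre) (by positivity)
      rw [one_div]
      exact inv_anti₀ (by norm_num) h4
  have hdiff : ∀ u, ‖u‖ ≤ 1 → ∀ z ∈ Metric.closedBall (0 : ℂ) R,
      DifferentiableAt ℂ (fun z => Ψ ((s u z ^ q)⁻¹)) z := by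
    intro u hu z hz
    have h1 : DifferentiableAt ℂ (fun z => (s u z ^ q)⁻¹) z :=
      DifferentiableAt.inv (by simp only [hs]; fun_prop) (pow_ne_zero _ (hkey u hu z hz).1)
    exact (hd _).comp z h1
  have hlower : ∀ u, ‖u‖ ≤ 1 → ∀ z ∈ Metric.closedBall (0 : ℂ) R,
      ψ (((2 * ρ) ^ (2 * q))⁻¹) ≤ ‖Ψ ((s u z ^ q)⁻¹)‖ := by
    intro u hu z hz
    have h1 := (hkey u hu z hz).2.2
    have h0 : 0 ≤ ((2 * ρ) ^ (2 * q))⁻¹ := by positivity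
    exact (hmono h0 (h0.trans h1) h1).trans (hlow _ (h0.trans h1))
  have hscale : ∀ b : ℝ, k.factorial * b / R ^ k * (2 * Real.exp 1) ^ k =
      k.factorial * (2 * Real.exp 1 / ε * τ / ρ) ^ k * b := by
    intro b
    rw [hR, div_pow, div_pow, mul_pow, mul_pow (2 * Real.exp 1 / ε), div_pow (2 * Real.exp 1)]
    field_simp
  have hclosure : closure (Metric.ball (0 : ℂ) R) = Metric.closedBall 0 R :=
    closure_ball _ hR0.ne'
  have hcdinv : ContDiffAt ℝ ⊤ (fun y => (ψ ((‖T y‖ ^ (2 * q))⁻¹))⁻¹) x :=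
    hcd.inv (hpsipos ((‖T x‖ ^ (2 * q))⁻¹) (inv_nonneg.2 (by positivity))).ne'
  constructor
  · rw [← hscale]
    refine norm_iteratedFDeriv_le_of_complex_lines hcd hR0 (fun u hu =>
      ⟨fun z => Ψ ((s u z ^ q)⁻¹), ?_, fun z hz => ?_, fun t _ => ?_⟩) k
    · refine DifferentiableOn.diffContOnCl fun z hz => ?_
      rw [hclosure] at hz
      exact (hdiff u hu z hz).differentiableWithinAt
    · refine (hup _).trans (hmono (norm_nonneg _) ?_
        (hkey u hu z (Metric.sphere_subset_closedBall hz)).2.1)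
      change 0 ≤ ((ρ / 2) ^ (2 * q))⁻¹
      positivity
    · simp only [hreal, hre]
  · rw [← hscale]
    refine norm_iteratedFDeriv_le_of_complex_lines hcdinv hR0 (fun u hu =>
      ⟨fun z => (Ψ ((s u z ^ q)⁻¹))⁻¹, ?_, fun z hz => ?_, fun t _ => ?_⟩) k
    · refine DifferentiableOn.diffContOnCl fun z hz => ?_
      rw [hclosure] at hz
      refine ((hdiff u hu z hz).inv ?_).differentiableWithinAt
      exact norm_pos_iff.1 ((hpsipos _ (by positivity)).trans_le (hlower u hu z hz))
    · rw [norm_inv]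
      exact inv_anti₀ (hpsipos _ (by positivity))
        (hlower u hu z (Metric.sphere_subset_closedBall hz))
    · beta_reduce
      rw [hreal, hre, Complex.ofReal_inv]

end Quadratic

lemma norm_smul_orthogonal_starProjection {n : ℕ} (V : Submodule ℝ (EuclideanSpace ℝ (Fin n)))
    {τ : ℝ} (hτ : 0 < τ) (x : EuclideanSpace ℝ (Fin n)) :
    ‖(τ • Vᗮ.starProjection) x‖ =
      τ * Metric.infDist x (V : Set (EuclideanSpace ℝ (Fin n))) := by
  have h1 : Vᗮ.starProjection x = x - V.starProjection x := by
    rw [Submodule.starProjection_orthogonal]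
    rfl
  rw [_root_.smul_apply, norm_smul, Real.norm_of_nonneg hτ.le, h1,
    Submodule.starProjection_minimal, Metric.infDist_eq_iInf]
  simp only [dist_eq_norm]
  rfl

lemma norm_apply_single_le {n k : ℕ}
    (m : ContinuousMultilinearMap ℝ (fun _ : Fin k => EuclideanSpace ℝ (Fin n)) ℝ)
    (e : Fin k → Fin n) : ‖m fun i => EuclideanSpace.single (e i) 1‖ ≤ ‖m‖ := by
  simpa using m.le_opNorm fun i => EuclideanSpace.single (e i) (1 : ℝ)


/-- for strongly regular `M` and a vector subspace `V ⊆ ℝⁿ` there are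
constants `d₁, d₂, d₃ > 0` depending only on `M` and `V` such that for every `τ > 0`
there is a real nonnegative `C^∞` function `v_τ` on `ℝⁿ` which lies in `C_M(ℝⁿ)`, is
flat on `V`, is positive off `V`, and whose reciprocal satisfies
`|D^J(1/v_τ)(x)| ≤ d₁ (d₂τ)^{|J|} |J|! M_{|J|} (h_M(d₃ τ dist(x,V)))⁻¹` off `V`. -/
theorem stmt17 {n : ℕ} (M : ℕ → ℝ) (hM : StronglyRegular M)
    (V : Submodule ℝ (EuclideanSpace ℝ (Fin n))) :
    ∃ d₁ d₂ d₃ : ℝ, 0 < d₁ ∧ 0 < d₂ ∧ 0 < d₃ ∧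
      ∀ τ : ℝ, 0 < τ →
        ∃ v : EuclideanSpace ℝ (Fin n) → ℝ,
          (∀ x, 0 ≤ v x) ∧
          ContDiff ℝ (⊤ : ℕ∞) v ∧
          (∃ C σ : ℝ, 0 < C ∧ 0 < σ ∧ ∀ (k : ℕ) (e : Fin k → Fin n)
              (x : EuclideanSpace ℝ (Fin n)),
            ‖mixedPartial Set.univ v k e x‖ ≤ C * σ ^ k * (Nat.factorial k : ℝ) * M k) ∧
          (∀ x ∈ (V : Set (EuclideanSpace ℝ (Fin n))), ∀ (k : ℕ) (e : Fin k → Fin n),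
            mixedPartial Set.univ v k e x = 0) ∧
          (∀ x, x ∉ (V : Set (EuclideanSpace ℝ (Fin n))) → 0 < v x) ∧
          (∀ (k : ℕ) (e : Fin k → Fin n),
            ∀ x ∉ (V : Set (EuclideanSpace ℝ (Fin n))),
            ‖mixedPartial ((V : Set (EuclideanSpace ℝ (Fin n)))ᶜ)
                (fun y => (v y)⁻¹) k e x‖ ≤
              d₁ * (d₂ * τ) ^ k * (Nat.factorial k : ℝ) * M k *
                (hfn M (d₃ * τ * Metric.infDist x (V : Set (EuclideanSpace ℝ (Fin n)))))⁻¹) := by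
  obtain ⟨A, h⟩ := hM
  have hpos := h.1
  obtain ⟨q, Ψ, ψ, B, D, hq, hB, hD, hd, hre, hup, hlow, hmono, hone, hdecay, hhpos, hgrow⟩ :=
    h.exists_entire_comparable
  obtain ⟨c, hc, hbd⟩ := exists_iteratedFDeriv_bounds (E := EuclideanSpace ℝ (Fin n))
    hq hd hre hup hlow hmono hone
  refine ⟨D, c / 2, 1 / (2 * B), hD, by positivity, by positivity, fun τ hτ => ?_⟩
  set T : EuclideanSpace ℝ (Fin n) →L[ℝ] EuclideanSpace ℝ (Fin n) :=
    τ • Vᗮ.starProjection with hTdef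
  have hTdist : ∀ x, ‖T x‖ = τ * Metric.infDist x (V : Set (EuclideanSpace ℝ (Fin n))) :=
    norm_smul_orthogonal_starProjection V hτ
  have hTV : ∀ x, T x = 0 ↔ x ∈ (V : Set (EuclideanSpace ℝ (Fin n))) := fun x => by
    rw [← norm_eq_zero, hTdist, mul_eq_zero, or_iff_right hτ.ne',
      ← (Submodule.closed_of_finiteDimensional V).mem_iff_infDist_zero ⟨0, V.zero_mem⟩]
  have hTle : ∀ u, ‖T u‖ ≤ τ * ‖u‖ := fun u => by
    rw [hTdist]
    refine mul_le_mul_of_nonneg_left ?_ hτ.le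
    rw [← dist_zero_right]
    exact Metric.infDist_le_dist_of_mem (SetLike.mem_coe.2 V.zero_mem)
  have hopen : IsOpen (V : Set (EuclideanSpace ℝ (Fin n)))ᶜ :=
    (Submodule.closed_of_finiteDimensional V).isOpen_compl
  set f : EuclideanSpace ℝ (Fin n) → ℝ := fun y => ψ ((‖T y‖ ^ (2 * q))⁻¹) with hf
  have hfpos : ∀ y, 0 < f y := fun y => zero_lt_one.trans_le (hone _ (by positivity))
  set v : EuclideanSpace ℝ (Fin n) → ℝ := (V : Set (EuclideanSpace ℝ (Fin n)))ᶜ.indicator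
    fun y => (f y)⁻¹ with hv
  have hvV : ∀ x ∈ (V : Set (EuclideanSpace ℝ (Fin n))), v x = 0 := fun x hx =>
    Set.indicator_of_notMem (by simpa using hx) _
  have hvf : ∀ x ∉ (V : Set (EuclideanSpace ℝ (Fin n))), v x = (f x)⁻¹ := fun x hx =>
    Set.indicator_of_mem (by simpa using hx) _
  have hev : ∀ x ∉ (V : Set (EuclideanSpace ℝ (Fin n))), v =ᶠ[𝓝 x] fun y => (f y)⁻¹ :=
    fun x hx => (hopen.eventually_mem hx).mono hvf
  have hρpos : ∀ x ∉ (V : Set (EuclideanSpace ℝ (Fin n))), 0 < ‖T x‖ := fun x hx =>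
    norm_pos_iff.2 fun h0 => hx ((hTV x).1 h0)
  have hvk : ∀ x ∉ (V : Set (EuclideanSpace ℝ (Fin n))), ∀ k j : ℕ,
      ‖iteratedFDeriv ℝ k v x‖ ≤
        k.factorial * (c * τ / ‖T x‖) ^ k * ((2 * ‖T x‖) ^ j * M j) := by
    intro x hx k j
    have hρ := hρpos x hx
    rw [((hev x hx).iteratedFDeriv ℝ k).eq_of_nhds]
    refine ((hbd T τ hτ hTle x (norm_pos_iff.1 hρ)).2 k).2.trans ?_
    refine mul_le_mul_of_nonneg_left ?_ (by positivity)
    have h1 := hdecay (2 * ‖T x‖) (by positivity) j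
    rwa [inv_le_iff_one_le_mul₀' (zero_lt_one.trans_le (hone _ (by positivity)))]
  have hsmooth : ∀ x ∉ (V : Set (EuclideanSpace ℝ (Fin n))), ContDiffAt ℝ ⊤ v x := by
    intro x hx
    have h1 : ContDiffAt ℝ ⊤ f x := (hbd T τ hτ hTle x (norm_pos_iff.1 (hρpos x hx))).1
    have h2 : ContDiffAt ℝ ⊤ (fun y => (f y)⁻¹) x := h1.inv (hfpos x).ne'
    exact h2.congr_of_eventuallyEq (hev x hx)
  obtain ⟨hcd, hflat⟩ := contDiff_of_flat hvV hsmooth fun k => by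
    have hMk := hpos (k + 2)
    refine ⟨k.factorial * (c * τ) ^ k * 2 ^ (k + 2) * M (k + 2) * τ ^ 2, by positivity,
      fun x hx y hy => (hvk y hy k (k + 2)).trans ?_⟩
    have hρ := hρpos y hy
    have h1 : ‖T y‖ ≤ τ * ‖y - x‖ := by
      simpa [(hTV x).2 hx] using hTle (y - x)
    have h2 : k.factorial * (c * τ / ‖T y‖) ^ k * ((2 * ‖T y‖) ^ (k + 2) * M (k + 2)) =
        k.factorial * (c * τ) ^ k * 2 ^ (k + 2) * M (k + 2) * ‖T y‖ ^ 2 := by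
      rw [div_pow, mul_pow 2, pow_add ‖T y‖]
      field_simp
    rw [h2, mul_assoc _ (τ ^ 2), ← mul_pow]
    gcongr
  refine ⟨v, fun x => Set.indicator_nonneg (fun y _ => (inv_pos.2 (hfpos y)).le) x, hcd,
    ⟨1, 2 * (c * τ), one_pos, by positivity, fun k e x => ?_⟩, fun x hx k e => ?_, fun x hx => ?_,
    fun k e x hx => ?_⟩
  · rw [mixedPartial, iteratedFDerivWithin_univ]
    refine (norm_apply_single_le _ e).trans ?_
    have hMk := hpos k
    by_cases hx : x ∈ (V : Set (EuclideanSpace ℝ (Fin n)))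
    · rw [hflat x hx, norm_zero]
      positivity
    · have hρ := hρpos x hx
      refine (hvk x hx k k).trans_eq ?_
      rw [div_pow, mul_pow 2, mul_pow 2]
      field_simp
  · rw [mixedPartial, iteratedFDerivWithin_univ, hflat x hx]
    rfl
  · rw [hvf x hx]
    exact inv_pos.2 (hfpos x)
  · have hρ := hρpos x hx
    have hMk := hpos k
    have hwithin : iteratedFDerivWithin ℝ k (fun y => (v y)⁻¹)
        (V : Set (EuclideanSpace ℝ (Fin n)))ᶜ x = iteratedFDeriv ℝ k f x := by
      rw [iteratedFDerivWithin_of_isOpen k hopen hx]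
      refine (Filter.EventuallyEq.iteratedFDeriv ℝ ?_ k).eq_of_nhds
      filter_upwards [hev x hx] with y hy
      rw [hy, inv_inv]
    rw [mixedPartial, hwithin]
    refine (norm_apply_single_le _ e).trans
      (((hbd T τ hτ hTle x (norm_pos_iff.1 hρ)).2 k).1.trans ?_)
    set t := ‖T x‖ / 2 with ht
    have ht0 : 0 < t := by positivity
    have htd : t / B =
        1 / (2 * B) * τ * Metric.infDist x (V : Set (EuclideanSpace ℝ (Fin n))) := by
      rw [ht, hTdist]
      field_simp
    rw [← htd]
    have h1 := hdecay t ht0 k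
    have h2 := hgrow t ht0
    have h3 := hhpos (t / B) (by positivity)
    set P := ψ ((t ^ (2 * q))⁻¹)
    have hP : 0 < P := zero_lt_one.trans_le (hone _ (by positivity))
    have hρt : ‖T x‖ = 2 * t := by rw [ht]; ring
    calc k.factorial * (c * τ / ‖T x‖) ^ k * P
        = k.factorial * (c / 2 * τ) ^ k * (t ^ k)⁻¹ * P := by
          have h4 : c * τ / ‖T x‖ = c / 2 * τ * t⁻¹ := by
            rw [hρt]
            field_simp
          rw [h4, mul_pow _ t⁻¹, inv_pow]
          ring
      _ ≤ k.factorial * (c / 2 * τ) ^ k * (P * M k) * P := by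
          gcongr
          rw [inv_le_iff_one_le_mul₀' (by positivity)]
          linarith
      _ = (c / 2 * τ) ^ k * k.factorial * M k * P ^ 2 := by ring
      _ ≤ (c / 2 * τ) ^ k * k.factorial * M k * (D / hfn M (t / B)) := by
          gcongr
          rwa [le_div_iff₀ h3]
      _ = _ := by ring
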